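/- Fix integers m ≥ 1, n ≥ 0 and reals ν > 0, σ² > 0, ρ² > 0. For every x^n = (x_1,…,x_n) ∈ (ℝ^m)^n, the matrix Σ̄_n = (1/(n+ν))·(Σ_{i=1}^n x_i x_iᵀ + νσ²I_m) − (1/((ν+n)(ρ²ν+n)))·Σ_{i,j=1}^n x_i x_jᵀ is symmetric positive definite. -/

import Mathlib

open MeasureTheory Matrix Real BigOperators

/-- Likelihood of `n` observations under the `m`-dimensional normal distribution
with mean `μ` and covariance `S`. -/
noncomputable def mvnLik (m n : ℕ) (x : Fin n → Fin m → ℝ) (μ : Fin m → ℝ)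
    (S : Matrix (Fin m) (Fin m) ℝ) : ℝ :=
  ∏ i : Fin n, (2 * π) ^ (-(m : ℝ) / 2) * S.det ^ (-(1 : ℝ) / 2) *
    Real.exp (-(1 / 2) * ((x i - μ) ⬝ᵥ (S⁻¹ *ᵥ (x i - μ))))

/-- The simple luckiness function `π(μ, Σ; ν, σ², ρ²)`. -/
noncomputable def luck (m : ℕ) (μ : Fin m → ℝ) (S : Matrix (Fin m) (Fin m) ℝ)
    (ν σ2 ρ2 : ℝ) : ℝ :=
  (2 * π) ^ (-(m : ℝ) * ν / 2) * S.det ^ (-ν / 2) *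
    Real.exp (-(ν / 2) *
      (S⁻¹ * (σ2 • (1 : Matrix (Fin m) (Fin m) ℝ) + ρ2 • vecMulVec μ μ)).trace)

/-- The generalized luckiness function `π(μ, Σ; ν, μ₀, Σ₀, ρ²)`. -/
noncomputable def luck2 (m : ℕ) (μ : Fin m → ℝ) (S : Matrix (Fin m) (Fin m) ℝ)
    (ν : ℝ) (μ0 : Fin m → ℝ) (S0 : Matrix (Fin m) (Fin m) ℝ) (ρ2 : ℝ) : ℝ :=
  (2 * π) ^ (-(m : ℝ) * ν / 2) * S.det ^ (-ν / 2) *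
    Real.exp (-(ν / 2) *
      (S⁻¹ * (S0 + ρ2 • vecMulVec (μ - μ0) (μ - μ0))).trace)

/-- MAP location estimate `μ̄_k` for the simple luckiness. -/
noncomputable def muBar (m k : ℕ) (ν ρ2 : ℝ) (x : Fin k → Fin m → ℝ) : Fin m → ℝ :=
  (1 / (k + ρ2 * ν)) • ∑ i : Fin k, x i

/-- MAP covariance estimate `Σ̄_k` for the simple luckiness. -/
noncomputable def sigmaBar (m k : ℕ) (ν σ2 ρ2 : ℝ) (x : Fin k → Fin m → ℝ) :
    Matrix (Fin m) (Fin m) ℝ :=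
  (1 / (k + ν)) •
      (∑ i : Fin k, vecMulVec (x i) (x i) + (ν * σ2) • (1 : Matrix (Fin m) (Fin m) ℝ))
    - (1 / ((ν + k) * (ρ2 * ν + k))) • ∑ i : Fin k, ∑ j : Fin k, vecMulVec (x i) (x j)

/-- MAP location estimate `μ̄_k` for the generalized luckiness. -/
noncomputable def muBar2 (m k : ℕ) (ν ρ2 : ℝ) (μ0 : Fin m → ℝ)
    (x : Fin k → Fin m → ℝ) : Fin m → ℝ :=
  μ0 + (1 / (k + ρ2 * ν)) • ∑ i : Fin k, (x i - μ0)

/-- MAP covariance estimate `Σ̄_k` for the generalized luckiness. -/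
noncomputable def sigmaBar2 (m k : ℕ) (ν ρ2 : ℝ) (μ0 : Fin m → ℝ)
    (S0 : Matrix (Fin m) (Fin m) ℝ) (x : Fin k → Fin m → ℝ) : Matrix (Fin m) (Fin m) ℝ :=
  (1 / (k + ν)) • (∑ i : Fin k, vecMulVec (x i - μ0) (x i - μ0) + ν • S0)
    - (1 / ((ν + k) * (ρ2 * ν + k))) •
        ∑ i : Fin k, ∑ j : Fin k, vecMulVec (x i - μ0) (x j - μ0)

/-- The multivariate gamma function `Γ_m(z)`. -/
noncomputable def multiGamma (m : ℕ) (z : ℝ) : ℝ :=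
  π ^ ((m : ℝ) * ((m : ℝ) - 1) / 4) * ∏ j : Fin m, Real.Gamma (z - (j : ℝ) / 2)

/-- The capacity `𝒞(m, n, ν, σ², ρ²)` (note: the fourth argument is `σ²`,
so `σ^{-mν} = (σ²)^{-mν/2}`). -/
noncomputable def capC (m n : ℕ) (ν σ2 ρ2 : ℝ) : ℝ :=
  σ2 ^ (-(m : ℝ) * ν / 2) *
    ((((n : ℝ) + ν) ^ ((n : ℝ) + ν) * (1 + n / (ρ2 * ν))) /
        ((2 * Real.exp 1) ^ ((n : ℝ) + ν) * (π * ν) ^ ν)) ^ ((m : ℝ) / 2) *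
    (multiGamma m (ν / 2) / multiGamma m (((n : ℝ) + ν) / 2))

/-- The pointwise supremum of likelihood times simple luckiness over all `μ`
and positive definite `Σ`. -/
noncomputable def supLik (m n : ℕ) (ν σ2 ρ2 : ℝ) (x : Fin n → Fin m → ℝ) : ℝ :=
  ⨆ p : (Fin m → ℝ) × {S : Matrix (Fin m) (Fin m) ℝ // S.PosDef},
    mvnLik m n x p.1 p.2.1 * luck m p.1 p.2.1 ν σ2 ρ2

/-- The pointwise supremum of likelihood times generalized luckiness over all `μ`
and positive definite `Σ`. -/
noncomputable def supLik2 (m n : ℕ) (ν : ℝ) (μ0 : Fin m → ℝ)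
    (S0 : Matrix (Fin m) (Fin m) ℝ) (ρ2 : ℝ) (x : Fin n → Fin m → ℝ) : ℝ :=
  ⨆ p : (Fin m → ℝ) × {S : Matrix (Fin m) (Fin m) ℝ // S.PosDef},
    mvnLik m n x p.1 p.2.1 * luck2 m p.1 p.2.1 ν μ0 S0 ρ2

/-- The density of the `m`-variate Student t-distribution with `d` degrees of
freedom, location `μ` and scale matrix `S`. -/
noncomputable def tDens (m : ℕ) (d : ℝ) (x μ : Fin m → ℝ)
    (S : Matrix (Fin m) (Fin m) ℝ) : ℝ :=
  Real.Gamma ((d + m) / 2) /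
      (Real.Gamma (d / 2) * (d * π) ^ ((m : ℝ) / 2) * S.det ^ ((1 : ℝ) / 2)) *
    (1 + (1 / d) * ((x - μ) ⬝ᵥ (S⁻¹ *ᵥ (x - μ)))) ^ (-(d + (m : ℝ)) / 2)

/-- The quadratic form of `sigmaBar` in terms of the scalar projections `v ⬝ᵥ x i`. -/
lemma dotProduct_sigmaBar_mulVec (m n : ℕ) (ν σ2 ρ2 : ℝ) (x : Fin n → Fin m → ℝ)
    (v : Fin m → ℝ) :
    v ⬝ᵥ (sigmaBar m n ν σ2 ρ2 x *ᵥ v) =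
      (1 / (n + ν)) * (∑ i, (v ⬝ᵥ x i) ^ 2 + ν * σ2 * (v ⬝ᵥ v))
        - (1 / ((ν + n) * (ρ2 * ν + n))) * (∑ i, v ⬝ᵥ x i) ^ 2 := by
  have h (a b : Fin m → ℝ) : v ⬝ᵥ (vecMulVec a b *ᵥ v) = (v ⬝ᵥ a) * (v ⬝ᵥ b) := by
    rw [vecMulVec_mulVec, op_smul_eq_smul, dotProduct_smul, smul_eq_mul, dotProduct_comm b v,
      mul_comm]
  simp only [sigmaBar, sub_mulVec, add_mulVec, smul_mulVec, sum_mulVec, one_mulVec,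
    dotProduct_sub, dotProduct_add, dotProduct_smul, dotProduct_sum, smul_eq_mul, h,
    sq, Finset.sum_mul_sum]

lemma isHermitian_sigmaBar (m n : ℕ) (ν σ2 ρ2 : ℝ) (x : Fin n → Fin m → ℝ) :
    (sigmaBar m n ν σ2 ρ2 x).IsHermitian := by
  rw [IsHermitian, conjTranspose_eq_transpose_of_trivial]
  simp only [sigmaBar, transpose_sub, transpose_add, transpose_smul, transpose_sum,
    transpose_vecMulVec, transpose_one]
  rw [Finset.sum_comm]

/-- the MAP covariance estimate `Σ̄_n` is symmetric positive definite. -/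
theorem sigmaBar_posDef (m n : ℕ) (hm : 1 ≤ m) (ν σ2 ρ2 : ℝ)
    (hν : 0 < ν) (hσ : 0 < σ2) (hρ : 0 < ρ2)
    (x : Fin n → Fin m → ℝ) :
    (sigmaBar m n ν σ2 ρ2 x).PosDef := by
  refine .of_dotProduct_mulVec_pos (isHermitian_sigmaBar m n ν σ2 ρ2 x) fun v hv => ?_
  have hvv : 0 < v ⬝ᵥ v := by simpa using dotProduct_star_self_pos_iff.mpr hv
  rw [star_trivial, dotProduct_sigmaBar_mulVec]
  have hc : 0 < ρ2 * ν + n := by positivity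
  have hcs : (∑ i, v ⬝ᵥ x i) ^ 2 / (ρ2 * ν + n) ≤ ∑ i, (v ⬝ᵥ x i) ^ 2 := by
    rw [div_le_iff₀' hc]
    refine (sq_sum_le_card_mul_sum_sq (s := Finset.univ)).trans ?_
    rw [Finset.card_univ, Fintype.card_fin]
    gcongr
    exact le_add_of_nonneg_left (by positivity)
  have hpos : 0 < 1 / (n + ν) * (∑ i, (v ⬝ᵥ x i) ^ 2 + ν * σ2 * (v ⬝ᵥ v)
      - (∑ i, v ⬝ᵥ x i) ^ 2 / (ρ2 * ν + n)) := by
    have : 0 < ν * σ2 * (v ⬝ᵥ v) := by positivity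
    exact mul_pos (by positivity) (by linarith)
  refine hpos.trans_eq ?_
  field_simp
  ring
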